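/- arXiv:math/0611341 — 4 statements merged into one kernel-verified Lean document; each statement's English description precedes it below -/
import Mathlib

section
/- For a symplectic form ω on a 2m-dimensional real vector space V, the complex spinor φ_ω = exp(√-1 ω) has annihilator E_{φ_ω} = {X − √-1 ι_X ω : X ∈ V ⊗ ℂ}, which has complex dimension 2m; hence φ_ω is a complex pure spinor. -/
set_option synthInstance.maxHeartbeats 1000000
set_option maxHeartbeats 1000000

open Module LinearMap TensorProduct

noncomputable section

variable (𝕜 : Type*) [Field 𝕜] (V : Type*) [AddCommGroup V] [Module 𝕜 V]

/-- The space of (poly)forms `Λ V*`. -/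
abbrev Sp := ExteriorAlgebra 𝕜 (Module.Dual 𝕜 V)

/-- Clifford action of `X + α ∈ V ⊕ V*` on `Λ V*`, `(X+α)·φ = ι_X φ + α ∧ φ`. -/
def gAct : (V × Module.Dual 𝕜 V) →ₗ[𝕜] Module.End 𝕜 (Sp 𝕜 V) :=
  (CliffordAlgebra.contractLeft (Q := (0 : QuadraticForm 𝕜 (Module.Dual 𝕜 V)))).comp
      ((Module.Dual.eval 𝕜 V).comp (LinearMap.fst 𝕜 V (Module.Dual 𝕜 V)))
    + (LinearMap.mul 𝕜 (Sp 𝕜 V)).comp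
      ((ExteriorAlgebra.ι 𝕜).comp (LinearMap.snd 𝕜 V (Module.Dual 𝕜 V)))

/-- Annihilator `E_φ = {X+α : ι_X φ + α ∧ φ = 0}` of a spinor. -/
def gAnn (φ : Sp 𝕜 V) : Submodule 𝕜 (V × Module.Dual 𝕜 V) :=
  LinearMap.ker ((gAct 𝕜 V).flip φ)

/-- The exponential `exp(B)` of an element of `Λ V*`, truncated beyond degree bound `n`. -/
def gExp (n : ℕ) (B : Sp 𝕜 V) : Sp 𝕜 V :=
  ∑ k ∈ Finset.range (n + 1), (k.factorial : 𝕜)⁻¹ • B ^ k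

variable (V : Type*) [AddCommGroup V] [Module ℝ V] [FiniteDimensional ℝ V]

/-- the canonical inclusion of a vector `X ∈ V` into the complexification `V ⊗ ℂ` -/
def cvec (X : V) : ℂ ⊗[ℝ] V := (1 : ℂ) ⊗ₜ X

/-- the canonical (ℝ-linear) map sending a real covector `α ∈ V*` to its complexification,
a complex covector on `V ⊗ ℂ` -/
def ccovL : Module.Dual ℝ V →ₗ[ℝ] Module.Dual ℂ (ℂ ⊗[ℝ] V) :=
  ((LinearMap.liftBaseChangeEquiv ℂ (M := V) (N := ℂ)).toLinearMap.restrictScalars ℝ).comp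
    (LinearMap.llcomp ℝ V ℝ ℂ Complex.ofRealAm.toLinearMap)

section EvenForms

variable {R M : Type*} [CommRing R] [AddCommGroup M] [Module R M]

/-- A two-form commutes with every one-form. -/
theorem ExteriorAlgebra.commute_ι_of_mem_two {b : ExteriorAlgebra R M} (hb : b ∈ ⋀[R]^2 M)
    (c : M) : Commute (ExteriorAlgebra.ι R c) b := by
  rw [exteriorPower, pow_two] at hb
  induction hb using Submodule.mul_induction_on' with
  | mem_mul_mem x hx y hy =>
    obtain ⟨x, rfl⟩ := hx
    obtain ⟨y, rfl⟩ := hy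
    have hx := eq_neg_of_add_eq_zero_left (ExteriorAlgebra.ι_add_mul_swap (R := R) c x)
    have hy := eq_neg_of_add_eq_zero_left (ExteriorAlgebra.ι_add_mul_swap (R := R) c y)
    rw [Commute, SemiconjBy, ← mul_assoc, hx, neg_mul, mul_assoc, hy, mul_neg, neg_neg, mul_assoc]
  | add x _ y _ hx hy => exact hx.add_right hy

/-- Contraction with a covector satisfies the ungraded Leibniz rule on products whose left factor
is a two-form. -/
theorem ExteriorAlgebra.contractLeft_mul_of_mem_two (d : Module.Dual R M)
    {b : ExteriorAlgebra R M} (hb : b ∈ ⋀[R]^2 M) (y : ExteriorAlgebra R M) :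
    CliffordAlgebra.contractLeft (Q := (0 : QuadraticForm R M)) d (b * y) =
      CliffordAlgebra.contractLeft (Q := (0 : QuadraticForm R M)) d b * y +
        b * CliffordAlgebra.contractLeft (Q := (0 : QuadraticForm R M)) d y := by
  rw [exteriorPower, pow_two] at hb
  induction hb using Submodule.mul_induction_on' with
  | mem_mul_mem u hu v hv =>
    obtain ⟨u, rfl⟩ := hu
    obtain ⟨v, rfl⟩ := hv
    simp only [ExteriorAlgebra.ι, mul_assoc, CliffordAlgebra.contractLeft_ι_mul,
      CliffordAlgebra.contractLeft_ι, mul_sub, sub_mul, smul_mul_assoc, mul_smul_comm,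
      Algebra.algebraMap_eq_smul_one, mul_one]
    abel
  | add u _ v _ hu hv =>
    rw [add_mul, map_add, hu, hv, map_add, add_mul, add_mul]
    abel

/-- If contracting a two-form `b` with `d` gives the one-form `c`, then contracting `b ^ (k + 1)`
gives `(k + 1) c ∧ b ^ k`. -/
theorem ExteriorAlgebra.contractLeft_pow_succ_of_mem_two (d : Module.Dual R M)
    {b : ExteriorAlgebra R M} (hb : b ∈ ⋀[R]^2 M) {c : M}
    (hc : CliffordAlgebra.contractLeft (Q := (0 : QuadraticForm R M)) d b =
      ExteriorAlgebra.ι R c) (k : ℕ) :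
    CliffordAlgebra.contractLeft (Q := (0 : QuadraticForm R M)) d (b ^ (k + 1)) =
      ((k : R) + 1) • (ExteriorAlgebra.ι R c * b ^ k) := by
  induction k with
  | zero => simp [hc]
  | succ k ih =>
    rw [pow_succ', ExteriorAlgebra.contractLeft_mul_of_mem_two d hb, ih, hc, mul_smul_comm,
      ← mul_assoc, ← (ExteriorAlgebra.commute_ι_of_mem_two hb c).eq, mul_assoc, ← pow_succ']
    push_cast
    module

end EvenForms

/-- Forms of degree larger than the dimension vanish. -/
theorem ExteriorAlgebra.eq_zero_of_finrank_lt {K M : Type*} [Field K] [AddCommGroup M] [Module K M]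
    [FiniteDimensional K M] {n : ℕ} (hn : Module.finrank K M < n) {b : ExteriorAlgebra K M}
    (hb : b ∈ ⋀[K]^n M) : b = 0 := by
  have h : Module.finrank K (⋀[K]^n M) = 0 := by
    rw [exteriorPower.finrank_eq, Nat.choose_eq_zero_of_lt hn]
  rw [Submodule.finrank_eq_zero] at h
  rwa [h, Submodule.mem_bot] at hb

section TruncatedExponential

variable {K W : Type*} [Field K] [AddCommGroup W] [Module K W]

/-- The truncated exponential of a nilpotent element is invertible. -/
theorem isUnit_gExp_of_isNilpotent (n : ℕ) {b : Sp K W} (hb : IsNilpotent b) :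
    IsUnit (gExp K W n b) := by
  have h : gExp K W n b =
      b * (∑ k ∈ Finset.range n, ((k + 1).factorial : K)⁻¹ • b ^ k) + 1 := by
    simp [gExp, Finset.sum_range_succ', Finset.mul_sum, pow_succ']
  rw [h]
  refine (Commute.isNilpotent_mul_right ?_ hb).isUnit_add_one
  exact Commute.sum_right _ _ _ fun k _ => ((Commute.refl b).pow_right k).smul_right _

/-- Contracting the truncated exponential of a two-form multiplies it by the contraction of the
two-form, up to the top term. -/
theorem contractLeft_gExp_succ [CharZero K] (d : Module.Dual K (Module.Dual K W)) {b : Sp K W}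
    (hb : b ∈ ⋀[K]^2 (Module.Dual K W)) {c : Module.Dual K W}
    (hc : CliffordAlgebra.contractLeft (Q := (0 : QuadraticForm K (Module.Dual K W))) d b =
      ExteriorAlgebra.ι K c) (n : ℕ) :
    CliffordAlgebra.contractLeft (Q := (0 : QuadraticForm K (Module.Dual K W))) d
        (gExp K W (n + 1) b) = ExteriorAlgebra.ι K c * gExp K W n b := by
  rw [gExp, Finset.sum_range_succ', map_add, map_sum, gExp, Finset.mul_sum]
  simp only [pow_zero, map_smul, CliffordAlgebra.contractLeft_one, smul_zero, add_zero]
  refine Finset.sum_congr rfl fun k _ => ?_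
  rw [ExteriorAlgebra.contractLeft_pow_succ_of_mem_two d hb hc, smul_smul, mul_smul_comm,
    Nat.factorial_succ]
  congr 1
  push_cast
  have : (k : K) + 1 ≠ 0 := Nat.cast_add_one_ne_zero k
  field_simp

theorem gExp_succ_of_pow_eq_zero {n : ℕ} {b : Sp K W} (hb : b ^ (n + 1) = 0) :
    gExp K W (n + 1) b = gExp K W n b := by
  rw [gExp, Finset.sum_range_succ, hb, smul_zero, add_zero, gExp]

/-- The annihilator of the exponential of a two-form `b` with `ι_X b = Ω X` is the graph
of `-Ω`. -/
theorem gAnn_gExp_of_mem_two [CharZero K] {n : ℕ} {b : Sp K W}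
    (hb : b ∈ ⋀[K]^2 (Module.Dual K W)) (hn : b ^ (n + 1) = 0)
    (Ω : W →ₗ[K] Module.Dual K W)
    (hΩ : ∀ X, gAct K W (X, 0) b = ExteriorAlgebra.ι K (Ω X)) :
    gAnn K W (gExp K W n b) = LinearMap.range (LinearMap.prod LinearMap.id (-Ω)) := by
  ext ⟨X, α⟩
  have hc : CliffordAlgebra.contractLeft (Q := (0 : QuadraticForm K (Module.Dual K W)))
      (Module.Dual.eval K W X) b = ExteriorAlgebra.ι K (Ω X) := by
    simpa [gAct] using hΩ X
  have hact : gAct K W (X, α) (gExp K W n b) =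
      ExteriorAlgebra.ι K (Ω X + α) * gExp K W n b := by
    have h := contractLeft_gExp_succ _ hb hc n
    rw [gExp_succ_of_pow_eq_zero hn] at h
    rw [map_add, add_mul, ← h]
    simp [gAct]
  have hmem : (X, α) ∈ gAnn K W (gExp K W n b) ↔ Ω X + α = 0 := by
    rw [gAnn, LinearMap.mem_ker, LinearMap.flip_apply, hact,
      (isUnit_gExp_of_isNilpotent n ⟨n + 1, hn⟩).mul_left_eq_zero,
      ExteriorAlgebra.ι_eq_zero_iff]
  rw [hmem, LinearMap.mem_range, add_comm, add_eq_zero_iff_eq_neg]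
  simp [Prod.ext_iff, eq_comm]

end TruncatedExponential

/-- for a symplectic form `ω` on a `2m`-dimensional real vector space `V`
(encoded by the skew nondegenerate map `ω : V → V*`, `X ↦ ι_X ω`, with exterior-algebra
incarnation `β` of `ω` on the complexification), the complex spinor `φ_ω = exp(√-1 ω)` has
annihilator `E_{φ_ω} = {X − √-1 ι_X ω : X ∈ V ⊗ ℂ}`, of complex dimension `2m`;
hence `φ_ω` is a complex pure spinor. -/
theorem exp_sqrtMinusOne_omega_is_pure
    (m : ℕ) (hdim : Module.finrank ℝ V = 2 * m)
    (ω : V →ₗ[ℝ] Module.Dual ℝ V) (hskew : ∀ X Y : V, ω X Y = - ω Y X)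
    (hnondeg : LinearMap.ker ω = ⊥)
    (β : Sp ℂ (ℂ ⊗[ℝ] V)) (hβdeg : β ∈ ⋀[ℂ]^2 (Module.Dual ℂ (ℂ ⊗[ℝ] V)))
    (hβ : ∀ X : V, gAct ℂ (ℂ ⊗[ℝ] V) (cvec V X, 0) β = ExteriorAlgebra.ι ℂ (ccovL V (ω X))) :
    gAnn ℂ (ℂ ⊗[ℝ] V) (gExp ℂ (ℂ ⊗[ℝ] V) (2 * m) (Complex.I • β)) =
      LinearMap.range
        (LinearMap.prod (LinearMap.id (M := ℂ ⊗[ℝ] V))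
          ((- Complex.I) • (LinearMap.liftBaseChange ℂ ((ccovL V).comp ω)))) ∧
      Module.finrank ℂ
        (gAnn ℂ (ℂ ⊗[ℝ] V) (gExp ℂ (ℂ ⊗[ℝ] V) (2 * m) (Complex.I • β))) = 2 * m := by
  have hW : Module.finrank ℂ (Module.Dual ℂ (ℂ ⊗[ℝ] V)) = 2 * m := by
    rw [Subspace.dual_finrank_eq, Module.finrank_baseChange, hdim]
  have hb : Complex.I • β ∈ ⋀[ℂ]^2 (Module.Dual ℂ (ℂ ⊗[ℝ] V)) :=
    Submodule.smul_mem _ _ hβdeg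
  have hpow : (Complex.I • β) ^ (2 * m + 1) = 0 := by
    refine ExteriorAlgebra.eq_zero_of_finrank_lt (n := 2 * (2 * m + 1)) (by omega) ?_
    rw [ExteriorAlgebra.exteriorPower, pow_mul]
    exact Submodule.pow_mem_pow _ hb _
  have hβ' (X : ℂ ⊗[ℝ] V) : gAct ℂ (ℂ ⊗[ℝ] V) (X, 0) β =
      ExteriorAlgebra.ι ℂ (LinearMap.liftBaseChange ℂ ((ccovL V).comp ω) X) := by
    induction X with
    | zero =>
      rw [Prod.mk_zero_zero, map_zero, map_zero, map_zero, LinearMap.zero_apply]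
    | tmul z v =>
      have h : ((z ⊗ₜ[ℝ] v, 0) : (ℂ ⊗[ℝ] V) × Module.Dual ℂ (ℂ ⊗[ℝ] V)) =
          z • (cvec V v, 0) := by
        simp [cvec, TensorProduct.smul_tmul']
      rw [h, map_smul, LinearMap.smul_apply, hβ, LinearMap.liftBaseChange_tmul, map_smul,
        LinearMap.comp_apply]
    | add X Y hX hY =>
      have h : ((X + Y, 0) : (ℂ ⊗[ℝ] V) × Module.Dual ℂ (ℂ ⊗[ℝ] V)) = (X, 0) + (Y, 0) := by
        simp
      rw [h, map_add, LinearMap.add_apply, hX, hY, map_add, map_add]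
  have hann := gAnn_gExp_of_mem_two hb hpow
    (Complex.I • LinearMap.liftBaseChange ℂ ((ccovL V).comp ω)) fun X => by
      rw [map_smul, hβ', LinearMap.smul_apply, map_smul]
  have hneg : -(Complex.I • LinearMap.liftBaseChange ℂ ((ccovL V).comp ω)) =
      (-Complex.I) • LinearMap.liftBaseChange ℂ ((ccovL V).comp ω) :=
    (neg_smul _ _).symm
  rw [hneg] at hann
  refine ⟨hann, ?_⟩
  rw [hann, LinearMap.finrank_range_of_inj fun X Y h => congrArg Prod.fst h,
    Module.finrank_baseChange, hdim]
end
end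

section
/- For a symplectic form ω on a 2m-dimensional real vector space V, the spinor pairing satisfies ⟨exp(√-1 ω), exp(−√-1 ω)⟩ = ((−2√-1)^m / m!) ω^m, which is nonzero; hence exp(√-1 ω) is a generalized Calabi–Yau structure on V. -/
set_option synthInstance.maxHeartbeats 1000000
set_option maxHeartbeats 1000000
set_option maxSynthPendingDepth 3

open Module LinearMap TensorProduct

noncomputable section

variable (𝕜 : Type*) [Field 𝕜] (V : Type*) [AddCommGroup V] [Module 𝕜 V]

def gProj (n : ℕ) : Sp 𝕜 V →ₗ[𝕜] Sp 𝕜 V :=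
  (Submodule.subtype _).comp
    ((DirectSum.component 𝕜 ℕ _ n).comp
      (DirectSum.decomposeLinearEquiv (fun i : ℕ => ⋀[𝕜]^i (Module.Dual 𝕜 V))).toLinearMap)

variable (W : Type*) [AddCommGroup W] [Module ℝ W]

/-- complex spinors on a real vector space `W`: `Λ W* ⊗ ℂ` -/
abbrev SpC := ℂ ⊗[ℝ] Sp ℝ W

/-- complex conjugation on `Λ W* ⊗ ℂ` -/
def conjSC : SpC W →ₗ[ℝ] SpC W :=
  TensorProduct.map Complex.conjAe.toLinearMap LinearMap.id

/-- the anti-automorphism `σ` reversing wedge factors, on `Λ W* ⊗ ℂ` -/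
def revSC : SpC W →ₗ[ℂ] SpC W :=
  LinearMap.baseChange ℂ (CliffordAlgebra.reverse (Q := (0 : QuadraticForm ℝ (Module.Dual ℝ W))))

/-- degree-`n` projection on `Λ W* ⊗ ℂ` -/
def projSC (n : ℕ) : SpC W →ₗ[ℂ] SpC W :=
  LinearMap.baseChange ℂ (gProj ℝ W n)

/-- spinor pairing `⟨φ,ψ⟩ = (σ(φ) ∧ ψ)ₙ` on `Λ W* ⊗ ℂ` -/
def pairSC (n : ℕ) (φ ψ : SpC W) : SpC W := projSC W n (revSC W φ * ψ)

/-- complexified Clifford action of `(W ⊕ W*) ⊗ ℂ` on `Λ W* ⊗ ℂ` -/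
def actC : (ℂ ⊗[ℝ] (W × Module.Dual ℝ W)) →ₗ[ℂ] (SpC W →ₗ[ℂ] SpC W) :=
  LinearMap.liftBaseChange ℂ
    ((LinearMap.baseChangeHom ℝ ℂ (Sp ℝ W) (Sp ℝ W)).comp (gAct ℝ W))

/-- annihilator of a complex spinor inside `(W ⊕ W*) ⊗ ℂ` -/
def annC (φ : SpC W) : Submodule ℂ (ℂ ⊗[ℝ] (W × Module.Dual ℝ W)) :=
  LinearMap.ker ((actC W).flip φ)

/-- truncated exponential in `Λ W* ⊗ ℂ` -/
def expC (n : ℕ) (B : SpC W) : SpC W :=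
  ∑ k ∈ Finset.range (n + 1), (k.factorial : ℂ)⁻¹ • B ^ k

/-- a generalized Calabi–Yau structure on the `n`-dimensional space `W`:
a complex pure spinor `φ` with `⟨φ, φ̄⟩ ≠ 0` -/
def IsGCY [FiniteDimensional ℝ W] (φ : SpC W) : Prop :=
  Module.finrank ℂ (annC W φ) = Module.finrank ℝ W ∧
    pairSC W (Module.finrank ℝ W) φ (conjSC W φ) ≠ 0

/-- the type of a complex spinor: the lowest degree in which it has a nonzero component -/
def typeOf (φ : SpC W) : ℕ := sInf {k : ℕ | projSC W k φ ≠ 0}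

section ExteriorAlgebra

variable {𝕜 V}

theorem gAct_apply (X : V) (α : Module.Dual 𝕜 V) (x : Sp 𝕜 V) :
    gAct 𝕜 V (X, α) x = gAct 𝕜 V (X, 0) x + ExteriorAlgebra.ι 𝕜 α * x := by
  simp [gAct]

theorem gAct_algebraMap (X : V) (r : 𝕜) :
    gAct 𝕜 V (X, 0) (algebraMap 𝕜 (Sp 𝕜 V) r) = 0 := by
  simp [gAct]

theorem gAct_ι_mul (X : V) (α : Module.Dual 𝕜 V) (x : Sp 𝕜 V) :
    gAct 𝕜 V (X, 0) (ExteriorAlgebra.ι 𝕜 α * x) =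
      α X • x - ExteriorAlgebra.ι 𝕜 α * gAct 𝕜 V (X, 0) x := by
  simpa [gAct] using
    CliffordAlgebra.contractLeft_ι_mul
      (Q := (0 : QuadraticForm 𝕜 (Module.Dual 𝕜 V))) (d := Module.Dual.eval 𝕜 V X) α x

/-- Elements of degree two are sums of products of two covectors. -/
theorem exteriorPower_two_induction {p : Sp 𝕜 V → Prop}
    (hι : ∀ α γ : Module.Dual 𝕜 V, p (ExteriorAlgebra.ι 𝕜 α * ExteriorAlgebra.ι 𝕜 γ))
    (hadd : ∀ x y, p x → p y → p (x + y)) {x : Sp 𝕜 V}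
    (hx : x ∈ ⋀[𝕜]^2 (Module.Dual 𝕜 V)) : p x := by
  rw [ExteriorAlgebra.exteriorPower, pow_two] at hx
  refine Submodule.mul_induction_on hx ?_ hadd
  rintro _ ⟨α, rfl⟩ _ ⟨γ, rfl⟩
  exact hι α γ

theorem ι_mul_ι_swap (α γ : Module.Dual 𝕜 V) :
    ExteriorAlgebra.ι 𝕜 α * ExteriorAlgebra.ι 𝕜 γ =
      -(ExteriorAlgebra.ι 𝕜 γ * ExteriorAlgebra.ι 𝕜 α) :=
  eq_neg_of_add_eq_zero_left (ExteriorAlgebra.ι_add_mul_swap α γ)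

theorem commute_ι_of_mem_two {β : Sp 𝕜 V} (hβ : β ∈ ⋀[𝕜]^2 (Module.Dual 𝕜 V))
    (α : Module.Dual 𝕜 V) : Commute β (ExteriorAlgebra.ι 𝕜 α) := by
  refine exteriorPower_two_induction (p := fun β => Commute β (ExteriorAlgebra.ι 𝕜 α))
    (fun γ δ => ?_) (fun _ _ => Commute.add_left) hβ
  rw [commute_iff_eq, mul_assoc, ι_mul_ι_swap δ α, mul_neg, ← mul_assoc, ι_mul_ι_swap γ α,
    neg_mul, neg_neg, mul_assoc]

theorem reverse_of_mem_two {β : Sp 𝕜 V} (hβ : β ∈ ⋀[𝕜]^2 (Module.Dual 𝕜 V)) :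
    CliffordAlgebra.reverse (Q := (0 : QuadraticForm 𝕜 (Module.Dual 𝕜 V))) β = -β := by
  refine exteriorPower_two_induction
    (p := fun x => CliffordAlgebra.reverse (Q := (0 : QuadraticForm 𝕜 (Module.Dual 𝕜 V))) x = -x)
    (fun γ δ => ?_) (fun x y hx hy => ?_) hβ
  · rw [CliffordAlgebra.reverse.map_mul]
    erw [CliffordAlgebra.reverse_ι, CliffordAlgebra.reverse_ι]
    exact ι_mul_ι_swap δ γ
  · rw [map_add, hx, hy, neg_add]

theorem reverse_pow_of_mem_two {β : Sp 𝕜 V} (hβ : β ∈ ⋀[𝕜]^2 (Module.Dual 𝕜 V)) (k : ℕ) :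
    CliffordAlgebra.reverse (Q := (0 : QuadraticForm 𝕜 (Module.Dual 𝕜 V))) (β ^ k) = (-β) ^ k := by
  induction k with
  | zero => simp
  | succ k ih =>
    rw [pow_succ, CliffordAlgebra.reverse.map_mul, ih, reverse_of_mem_two hβ, pow_succ']

theorem pow_mem_of_mem_two {β : Sp 𝕜 V} (hβ : β ∈ ⋀[𝕜]^2 (Module.Dual 𝕜 V)) (k : ℕ) :
    β ^ k ∈ ⋀[𝕜]^(2 * k) (Module.Dual 𝕜 V) := by
  rw [ExteriorAlgebra.exteriorPower, pow_mul]
  exact Submodule.pow_mem_pow _ hβ k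

theorem ι_mul_mem {k : ℕ} {x : Sp 𝕜 V} (hx : x ∈ ⋀[𝕜]^k (Module.Dual 𝕜 V))
    (α : Module.Dual 𝕜 V) :
    ExteriorAlgebra.ι 𝕜 α * x ∈ ⋀[𝕜]^(k + 1) (Module.Dual 𝕜 V) := by
  rw [ExteriorAlgebra.exteriorPower, pow_succ']
  exact Submodule.mul_mem_mul ⟨α, rfl⟩ hx

theorem gProj_of_mem {k : ℕ} {x : Sp 𝕜 V} (hx : x ∈ ⋀[𝕜]^k (Module.Dual 𝕜 V)) (n : ℕ) :
    gProj 𝕜 V n x = if k = n then x else 0 := by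
  change ((DirectSum.decompose (fun i : ℕ => ⋀[𝕜]^i (Module.Dual 𝕜 V)) x n : _) : Sp 𝕜 V) = _
  split_ifs with h
  · subst h
    exact DirectSum.decompose_of_mem_same _ hx
  · exact DirectSum.decompose_of_mem_ne _ hx h

theorem gAct_mul_of_mem_two {β : Sp 𝕜 V} (hβ : β ∈ ⋀[𝕜]^2 (Module.Dual 𝕜 V)) (X : V)
    (x : Sp 𝕜 V) :
    gAct 𝕜 V (X, 0) (β * x) = gAct 𝕜 V (X, 0) β * x + β * gAct 𝕜 V (X, 0) x := by
  refine exteriorPower_two_induction (p := fun β => gAct 𝕜 V (X, 0) (β * x) =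
    gAct 𝕜 V (X, 0) β * x + β * gAct 𝕜 V (X, 0) x) (fun α γ => ?_) (fun y z hy hz => ?_) hβ
  · have hγ : gAct 𝕜 V (X, 0) (ExteriorAlgebra.ι 𝕜 γ) = algebraMap 𝕜 (Sp 𝕜 V) (γ X) := by
      have h := gAct_ι_mul X γ (algebraMap 𝕜 (Sp 𝕜 V) 1)
      rw [gAct_algebraMap] at h
      simpa [Algebra.algebraMap_eq_smul_one] using h
    rw [mul_assoc, gAct_ι_mul, gAct_ι_mul, gAct_ι_mul, hγ, Algebra.algebraMap_eq_smul_one]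
    simp only [mul_sub, sub_mul, smul_mul_assoc, mul_smul_comm, mul_one, mul_assoc]
    abel
  · rw [add_mul, map_add, hy, hz, map_add]
    simp only [add_mul]
    abel

/-- Contraction acts on powers of a two-form as a derivation. -/
theorem gAct_pow_succ {β : Sp 𝕜 V} (hβ : β ∈ ⋀[𝕜]^2 (Module.Dual 𝕜 V)) {X : V}
    {α : Module.Dual 𝕜 V} (h : gAct 𝕜 V (X, 0) β = ExteriorAlgebra.ι 𝕜 α) (k : ℕ) :
    gAct 𝕜 V (X, 0) (β ^ (k + 1)) = ((k : 𝕜) + 1) • (ExteriorAlgebra.ι 𝕜 α * β ^ k) := by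
  induction k with
  | zero => simp [h]
  | succ k ih =>
    rw [pow_succ', gAct_mul_of_mem_two hβ, ih, h, mul_smul_comm, ← mul_assoc,
      (commute_ι_of_mem_two hβ α).eq, mul_assoc, ← pow_succ', Nat.cast_succ, add_smul (_ + _),
      one_smul, add_comm]

/-- The Euler operator `∑ eⁱ ∧ ι_{eᵢ}` multiplies elements of degree `k` by `k`. -/
theorem sum_ι_coord_mul_gAct {ι : Type*} [Fintype ι] (b : Basis ι 𝕜 V) {k : ℕ} {x : Sp 𝕜 V}
    (hx : x ∈ ⋀[𝕜]^k (Module.Dual 𝕜 V)) :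
    ∑ i, ExteriorAlgebra.ι 𝕜 (b.coord i) * gAct 𝕜 V (b i, 0) x = (k : 𝕜) • x := by
  induction k generalizing x with
  | zero =>
    rw [ExteriorAlgebra.exteriorPower, pow_zero] at hx
    obtain ⟨r, rfl⟩ := Submodule.mem_one.1 hx
    simp [gAct_algebraMap]
  | succ k ih =>
    rw [ExteriorAlgebra.exteriorPower, pow_succ'] at hx
    refine Submodule.mul_induction_on hx ?_ fun y z hy hz => ?_
    · rintro _ ⟨α, rfl⟩ y hy
      have hα : ∑ i, α (b i) • ExteriorAlgebra.ι 𝕜 (b.coord i) = ExteriorAlgebra.ι 𝕜 α := by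
        simp_rw [← map_smul, ← map_sum, b.sum_dual_apply_smul_coord]
      have hterm : ∀ i, ExteriorAlgebra.ι 𝕜 (b.coord i) *
          gAct 𝕜 V (b i, 0) (ExteriorAlgebra.ι 𝕜 α * y) =
          (α (b i) • ExteriorAlgebra.ι 𝕜 (b.coord i)) * y +
          ExteriorAlgebra.ι 𝕜 α * (ExteriorAlgebra.ι 𝕜 (b.coord i) * gAct 𝕜 V (b i, 0) y) := by
        intro i
        rw [gAct_ι_mul, mul_sub, ← mul_assoc, ← mul_assoc, ι_mul_ι_swap _ α, neg_mul,
          sub_neg_eq_add, mul_smul_comm, smul_mul_assoc]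
      rw [Finset.sum_congr rfl fun i _ => hterm i, Finset.sum_add_distrib, ← Finset.sum_mul, hα,
        ← Finset.mul_sum, ih hy, mul_smul_comm, Nat.cast_succ, add_smul, one_smul, add_comm]
    · simp only [map_add, mul_add, Finset.sum_add_distrib, smul_add, hy, hz]

variable [FiniteDimensional 𝕜 V]

/-- A nonzero homogeneous element killed by every covector has top degree. -/
theorem eq_finrank_of_ι_mul_eq_zero [CharZero 𝕜] {k : ℕ} {x : Sp 𝕜 V}
    (hx : x ∈ ⋀[𝕜]^k (Module.Dual 𝕜 V))
    (h : ∀ α : Module.Dual 𝕜 V, ExteriorAlgebra.ι 𝕜 α * x = 0) (hx0 : x ≠ 0) :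
    k = Module.finrank 𝕜 V := by
  have b := Module.finBasis 𝕜 V
  have hterm : ∀ i, ExteriorAlgebra.ι 𝕜 (b.coord i) * gAct 𝕜 V (b i, 0) x = x := by
    intro i
    have h' := gAct_ι_mul (b i) (b.coord i) x
    rw [h, map_zero] at h'
    simpa using (sub_eq_zero.1 h'.symm).symm
  have hsum := sum_ι_coord_mul_gAct b hx
  rw [Finset.sum_congr rfl fun i _ => hterm i, Finset.sum_const, Finset.card_univ,
    Fintype.card_fin, ← Nat.cast_smul_eq_nsmul 𝕜] at hsum
  exact_mod_cast (smul_left_injective 𝕜 hx0 hsum).symm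

theorem eq_zero_of_mem_of_finrank_lt {k : ℕ} {x : Sp 𝕜 V}
    (hx : x ∈ ⋀[𝕜]^k (Module.Dual 𝕜 V)) (hk : Module.finrank 𝕜 V < k) : x = 0 := by
  rw [← ExteriorAlgebra.ιMulti_span_fixedDegree] at hx
  refine (Submodule.mem_bot 𝕜).1 ((Submodule.span_le.2 ?_) hx)
  rintro _ ⟨v, rfl⟩
  refine AlternatingMap.map_linearDependent _ v fun hv => ?_
  have := hv.fintype_card_le_finrank
  rw [Fintype.card_fin, Subspace.dual_finrank_eq] at this
  omega

variable {β : Sp 𝕜 V} {ω : V →ₗ[𝕜] Module.Dual 𝕜 V}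

theorem surjective_of_ker_eq_bot (hω : LinearMap.ker ω = ⊥) : Function.Surjective ω :=
  (LinearMap.injective_iff_surjective_of_finrank_eq_finrank
    (Subspace.dual_finrank_eq (K := 𝕜) (V := V)).symm).1 (LinearMap.ker_eq_bot.1 hω)

/-- The top power of a symplectic form does not vanish. -/
theorem symplectic_pow_ne_zero [CharZero 𝕜] {m : ℕ} (hdim : Module.finrank 𝕜 V = 2 * m)
    (hω : LinearMap.ker ω = ⊥) (hβdeg : β ∈ ⋀[𝕜]^2 (Module.Dual 𝕜 V))
    (hβ : ∀ X : V, gAct 𝕜 V (X, 0) β = ExteriorAlgebra.ι 𝕜 (ω X)) : β ^ m ≠ 0 := by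
  have hex : ∃ k, β ^ k = 0 :=
    ⟨m + 1, eq_zero_of_mem_of_finrank_lt (pow_mem_of_mem_two hβdeg _) (by omega)⟩
  classical
  obtain ⟨k, hk⟩ : ∃ k, Nat.find hex = k + 1 := by
    refine Nat.exists_eq_succ_of_ne_zero fun h0 => ?_
    have h := Nat.find_spec hex
    rw [h0, pow_zero, ← map_one (algebraMap 𝕜 (Sp 𝕜 V)),
      ExteriorAlgebra.algebraMap_eq_zero_iff] at h
    exact one_ne_zero h
  have hzero : β ^ (k + 1) = 0 := hk ▸ Nat.find_spec hex
  have hne : β ^ k ≠ 0 := Nat.find_min hex (by omega)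
  have hkill : ∀ α : Module.Dual 𝕜 V, ExteriorAlgebra.ι 𝕜 α * β ^ k = 0 := by
    intro α
    obtain ⟨X, rfl⟩ := surjective_of_ker_eq_bot hω α
    have h := gAct_pow_succ hβdeg (hβ X) k
    rw [hzero, map_zero] at h
    exact (smul_eq_zero.1 h.symm).resolve_left (Nat.cast_add_one_ne_zero k)
  have := eq_finrank_of_ι_mul_eq_zero (pow_mem_of_mem_two hβdeg k) hkill hne
  obtain rfl : k = m := by omega
  exact hne

end ExteriorAlgebra

section ComplexSpinors

variable {W}

theorem expC_tmul (n : ℕ) (z : ℂ) (β : Sp ℝ W) :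
    expC W n (z ⊗ₜ β) =
      ∑ k ∈ Finset.range (n + 1), ((k.factorial : ℂ)⁻¹ * z ^ k) ⊗ₜ[ℝ] (β ^ k) := by
  simp only [expC, Algebra.TensorProduct.tmul_pow, TensorProduct.smul_tmul', smul_eq_mul]

theorem conjSC_expC (n : ℕ) (β : Sp ℝ W) :
    conjSC W (expC W n (Complex.I ⊗ₜ β)) = expC W n ((-Complex.I) ⊗ₜ β) := by
  simp [expC_tmul, conjSC]

theorem revSC_expC (n : ℕ) {β : Sp ℝ W} (hβ : β ∈ ⋀[ℝ]^2 (Module.Dual ℝ W)) (z : ℂ) :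
    revSC W (expC W n (z ⊗ₜ β)) = expC W n ((-z) ⊗ₜ β) := by
  simp only [expC_tmul, revSC, map_sum, LinearMap.baseChange_tmul]
  refine Finset.sum_congr rfl fun k _ => ?_
  rw [reverse_pow_of_mem_two hβ, neg_pow β, neg_pow z]
  rcases Nat.even_or_odd k with h | h <;>
    simp [h.neg_one_pow, TensorProduct.tmul_neg, TensorProduct.neg_tmul]

theorem projSC_tmul {n k : ℕ} (z : ℂ) {x : Sp ℝ W} (hx : x ∈ ⋀[ℝ]^k (Module.Dual ℝ W)) :
    projSC W n (z ⊗ₜ x) = if k = n then z ⊗ₜ x else 0 := by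
  rw [projSC, LinearMap.baseChange_tmul, gProj_of_mem hx]
  split_ifs <;> simp

theorem projSC_expC_mul_expC (m : ℕ) {β : Sp ℝ W} (hβ : β ∈ ⋀[ℝ]^2 (Module.Dual ℝ W))
    (z w : ℂ) :
    projSC W (2 * m) (expC W (2 * m) (z ⊗ₜ β) * expC W (2 * m) (w ⊗ₜ β)) =
      ((z + w) ^ m / (m.factorial : ℂ)) • ((1 : ℂ) ⊗ₜ[ℝ] (β ^ m)) := by
  have hsub : Finset.HasAntidiagonal.antidiagonal m ⊆
      Finset.range (2 * m + 1) ×ˢ Finset.range (2 * m + 1) := by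
    rintro ⟨i, j⟩ h
    simp only [Finset.HasAntidiagonal.mem_antidiagonal, Finset.mem_product, Finset.mem_range] at h ⊢
    omega
  have hterm : ∀ p : ℕ × ℕ, projSC W (2 * m)
      ((((p.1.factorial : ℂ)⁻¹ * z ^ p.1) ⊗ₜ[ℝ] (β ^ p.1)) *
        (((p.2.factorial : ℂ)⁻¹ * w ^ p.2) ⊗ₜ[ℝ] (β ^ p.2))) =
      if p.1 + p.2 = m then (((p.1.factorial : ℂ)⁻¹ * z ^ p.1) *
        ((p.2.factorial : ℂ)⁻¹ * w ^ p.2)) • ((1 : ℂ) ⊗ₜ[ℝ] (β ^ m)) else 0 := by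
    intro p
    rw [Algebra.TensorProduct.tmul_mul_tmul, ← pow_add, projSC_tmul _ (pow_mem_of_mem_two hβ _)]
    by_cases h : p.1 + p.2 = m
    · simp [h, TensorProduct.smul_tmul']
    · simp [h]
  rw [expC_tmul, expC_tmul, Finset.sum_mul_sum, ← Finset.sum_product', map_sum,
    Finset.sum_congr rfl fun p _ => hterm p, ← Finset.sum_subset hsub]
  · rw [Finset.sum_congr rfl fun p hp => if_pos (Finset.HasAntidiagonal.mem_antidiagonal.1 hp),
      ← Finset.sum_smul, (Commute.all z w).add_pow', Finset.sum_div]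
    congr 1
    refine Finset.sum_congr rfl fun p hp => ?_
    obtain rfl := Finset.HasAntidiagonal.mem_antidiagonal.1 hp
    have h := (p.1 + p.2).choose_mul_factorial_mul_factorial (Nat.le_add_right _ _)
    rw [Nat.add_sub_cancel_left] at h
    have h1 : ((p.1.factorial : ℂ)) ≠ 0 := Nat.cast_ne_zero.2 (Nat.factorial_ne_zero _)
    have h2 : ((p.2.factorial : ℂ)) ≠ 0 := Nat.cast_ne_zero.2 (Nat.factorial_ne_zero _)
    have h3 : (((p.1 + p.2).factorial : ℂ)) ≠ 0 := Nat.cast_ne_zero.2 (Nat.factorial_ne_zero _)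
    rw [← @Nat.cast_inj ℂ] at h
    push_cast at h
    rw [nsmul_eq_mul, eq_div_iff h3, ← h]
    field_simp
  · intro p _ hp
    exact if_neg fun h => hp (Finset.HasAntidiagonal.mem_antidiagonal.2 h)

theorem actC_tmul_apply (z w : ℂ) (u : W × Module.Dual ℝ W) (x : Sp ℝ W) :
    actC W (z ⊗ₜ u) (w ⊗ₜ x) = (z * w) ⊗ₜ[ℝ] gAct ℝ W u x := by
  simp [actC, LinearMap.liftBaseChange_tmul, TensorProduct.smul_tmul']

variable {β : Sp ℝ W} {ω : W →ₗ[ℝ] Module.Dual ℝ W}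

/-- A complex covector is recovered from its wedge product with `exp(zβ)`. -/
theorem projSC_one_baseChange_ι_mul_expC (n : ℕ) (hβdeg : β ∈ ⋀[ℝ]^2 (Module.Dual ℝ W))
    (z : ℂ) (ξ : ℂ ⊗[ℝ] Module.Dual ℝ W) :
    projSC W 1 (LinearMap.baseChange ℂ (ExteriorAlgebra.ι ℝ) ξ * expC W n (z ⊗ₜ β)) =
      LinearMap.baseChange ℂ (ExteriorAlgebra.ι ℝ) ξ := by
  induction ξ using TensorProduct.induction_on with
  | zero => simp
  | add x y hx hy => rw [map_add, add_mul, map_add, hx, hy]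
  | tmul c α =>
    rw [LinearMap.baseChange_tmul, expC_tmul, Finset.mul_sum, map_sum,
      Finset.sum_eq_single_of_mem 0 (by simp)]
    · rw [Algebra.TensorProduct.tmul_mul_tmul,
        projSC_tmul _ (ι_mul_mem (pow_mem_of_mem_two hβdeg 0) α)]
      simp
    · intro k _ hk
      rw [Algebra.TensorProduct.tmul_mul_tmul,
        projSC_tmul _ (ι_mul_mem (pow_mem_of_mem_two hβdeg k) α), if_neg (by omega)]

theorem baseChange_ι_injective :
    Function.Injective (LinearMap.baseChange ℂ
      (ExteriorAlgebra.ι ℝ : Module.Dual ℝ W →ₗ[ℝ] Sp ℝ W)) := by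
  have h : (ExteriorAlgebra.ιInv : Sp ℝ W →ₗ[ℝ] _) ∘ₗ ExteriorAlgebra.ι ℝ = LinearMap.id :=
    LinearMap.ext ExteriorAlgebra.ι_leftInverse
  refine Function.LeftInverse.injective
    (g := LinearMap.baseChange ℂ (ExteriorAlgebra.ιInv : Sp ℝ W →ₗ[ℝ] _)) fun ξ => ?_
  rw [← LinearMap.comp_apply, ← LinearMap.baseChange_comp, h, LinearMap.baseChange_id,
    LinearMap.id_apply]

variable [FiniteDimensional ℝ W]

/-- Contracting `exp(zβ)` by a vector is wedging it with `z ω(X)`. -/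
theorem actC_expC_tmul {m : ℕ} (hdim : Module.finrank ℝ W = 2 * m)
    (hβdeg : β ∈ ⋀[ℝ]^2 (Module.Dual ℝ W))
    (hβ : ∀ X : W, gAct ℝ W (X, 0) β = ExteriorAlgebra.ι ℝ (ω X)) (z c : ℂ)
    (X : W) (α : Module.Dual ℝ W) :
    actC W (c ⊗ₜ (X, α)) (expC W (2 * m) (z ⊗ₜ β)) =
      ((c * z) ⊗ₜ[ℝ] ExteriorAlgebra.ι ℝ (ω X) + c ⊗ₜ[ℝ] ExteriorAlgebra.ι ℝ α) *
        expC W (2 * m) (z ⊗ₜ β) := by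
  have hlast : ExteriorAlgebra.ι ℝ (ω X) * β ^ (2 * m) = 0 :=
    eq_zero_of_mem_of_finrank_lt (ι_mul_mem (pow_mem_of_mem_two hβdeg _) _) (by omega)
  simp only [expC_tmul, map_sum, actC_tmul_apply, add_mul, Finset.mul_sum,
    Algebra.TensorProduct.tmul_mul_tmul]
  simp only [gAct_apply X α, TensorProduct.tmul_add, Finset.sum_add_distrib]
  congr 1
  have hone : gAct ℝ W (X, 0) (β ^ 0) = 0 := by
    rw [pow_zero, ← map_one (algebraMap ℝ (Sp ℝ W)), gAct_algebraMap]
  rw [Finset.sum_range_succ', Finset.sum_range_succ, hlast, hone, TensorProduct.tmul_zero,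
    TensorProduct.tmul_zero]
  congr 1
  refine Finset.sum_congr rfl fun k _ => ?_
  rw [gAct_pow_succ hβdeg (hβ X), ← TensorProduct.smul_tmul]
  congr 1
  rw [Complex.real_smul, Nat.factorial_succ]
  have h1 : ((k.factorial : ℂ)) ≠ 0 := Nat.cast_ne_zero.2 (Nat.factorial_ne_zero _)
  have h2 : ((k : ℂ) + 1) ≠ 0 := Nat.cast_add_one_ne_zero k
  push_cast
  field_simp
  ring

/-- The spinor `exp(zβ)` is pure. -/
theorem finrank_annC_expC {m : ℕ} (hdim : Module.finrank ℝ W = 2 * m)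
    (hβdeg : β ∈ ⋀[ℝ]^2 (Module.Dual ℝ W))
    (hβ : ∀ X : W, gAct ℝ W (X, 0) β = ExteriorAlgebra.ι ℝ (ω X)) (z : ℂ) :
    Module.finrank ℂ (annC W (expC W (2 * m) (z ⊗ₜ β))) = Module.finrank ℝ W := by
  let T : (ℂ ⊗[ℝ] (W × Module.Dual ℝ W)) →ₗ[ℂ] ℂ ⊗[ℝ] Module.Dual ℝ W :=
    z • LinearMap.baseChange ℂ (ω ∘ₗ LinearMap.fst ℝ W (Module.Dual ℝ W)) +
      LinearMap.baseChange ℂ (LinearMap.snd ℝ W (Module.Dual ℝ W))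
  have hact : ∀ u, actC W u (expC W (2 * m) (z ⊗ₜ β)) =
      LinearMap.baseChange ℂ (ExteriorAlgebra.ι ℝ) (T u) * expC W (2 * m) (z ⊗ₜ β) := by
    intro u
    induction u using TensorProduct.induction_on with
    | zero => simp
    | add x y hx hy => rw [map_add, LinearMap.add_apply, hx, hy, map_add, map_add, add_mul]
    | tmul c u =>
      rw [actC_expC_tmul hdim hβdeg hβ z c u.1 u.2]
      simp [T, TensorProduct.smul_tmul', mul_comm]
  have hker : annC W (expC W (2 * m) (z ⊗ₜ β)) = LinearMap.ker T := by
    ext u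
    rw [annC, LinearMap.mem_ker, LinearMap.flip_apply, hact, LinearMap.mem_ker]
    refine ⟨fun h => baseChange_ι_injective ?_, fun h => by rw [h, map_zero, zero_mul]⟩
    rw [← projSC_one_baseChange_ι_mul_expC (2 * m) hβdeg z, h, map_zero, map_zero]
  have hT : LinearMap.range T = ⊤ := by
    refine LinearMap.range_eq_top.2 fun ξ =>
      ⟨LinearMap.baseChange ℂ (LinearMap.inr ℝ W (Module.Dual ℝ W)) ξ, ?_⟩
    induction ξ using TensorProduct.induction_on with
    | zero => simp
    | add x y hx hy => rw [map_add, map_add, hx, hy]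
    | tmul c α => simp [T]
  have hrank := LinearMap.finrank_range_add_finrank_ker T
  rw [hT, finrank_top, Module.finrank_baseChange, Module.finrank_baseChange, Module.finrank_prod,
    Subspace.dual_finrank_eq] at hrank
  rw [hker]
  omega

end ComplexSpinors

/-- for a symplectic form `ω` on a `2m`-dimensional real vector space `V`
(encoded by the skew nondegenerate map `ω : V → V*` with exterior-algebra incarnation `β`),
the spinor pairing satisfies `⟨exp(√-1 ω), exp(−√-1 ω)⟩ = ((−2√-1)^m / m!) ω^m ≠ 0`;
hence `exp(√-1 ω)` is a generalized Calabi–Yau structure on `V`. -/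
theorem exp_omega_pairing_and_GCY
    (V : Type*) [AddCommGroup V] [Module ℝ V] [FiniteDimensional ℝ V]
    (m : ℕ) (hdim : Module.finrank ℝ V = 2 * m)
    (ω : V →ₗ[ℝ] Module.Dual ℝ V) (hskew : ∀ X Y : V, ω X Y = - ω Y X)
    (hnondeg : LinearMap.ker ω = ⊥)
    (β : Sp ℝ V) (hβdeg : β ∈ ⋀[ℝ]^2 (Module.Dual ℝ V))
    (hβ : ∀ X : V, gAct ℝ V (X, 0) β = ExteriorAlgebra.ι ℝ (ω X)) :
    pairSC V (2 * m) (expC V (2 * m) (Complex.I ⊗ₜ β))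
        (conjSC V (expC V (2 * m) (Complex.I ⊗ₜ β))) =
      ((-2 * Complex.I) ^ m / (m.factorial : ℂ)) • ((1 : ℂ) ⊗ₜ (β ^ m)) ∧
    pairSC V (2 * m) (expC V (2 * m) (Complex.I ⊗ₜ β))
        (conjSC V (expC V (2 * m) (Complex.I ⊗ₜ β))) ≠ 0 ∧
    IsGCY V (expC V (2 * m) (Complex.I ⊗ₜ β)) := by
  have hpair : pairSC V (2 * m) (expC V (2 * m) (Complex.I ⊗ₜ β))
      (conjSC V (expC V (2 * m) (Complex.I ⊗ₜ β))) =
      ((-2 * Complex.I) ^ m / (m.factorial : ℂ)) • ((1 : ℂ) ⊗ₜ (β ^ m)) := by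
    rw [pairSC, conjSC_expC, revSC_expC _ hβdeg, projSC_expC_mul_expC m hβdeg]
    congr 3
    ring
  have hne : pairSC V (2 * m) (expC V (2 * m) (Complex.I ⊗ₜ β))
      (conjSC V (expC V (2 * m) (Complex.I ⊗ₜ β))) ≠ 0 := by
    rw [hpair]
    refine smul_ne_zero (div_ne_zero (pow_ne_zero _ (by simp))
      (Nat.cast_ne_zero.2 (Nat.factorial_ne_zero _))) fun h => ?_
    exact symplectic_pow_ne_zero hdim hnondeg hβdeg hβ
      ((Module.FaithfullyFlat.one_tmul_eq_zero_iff ℝ (Sp ℝ V) _).1 h)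
  exact ⟨hpair, hne, finrank_annC_expC hdim hβdeg hβ Complex.I, hdim ▸ hne⟩
end
end

section
/- If φ is a generalized Calabi–Yau structure on V and B ∈ Λ²V* is a real 2-form, then ⟨exp(B) φ, conj(exp(B) φ)⟩ = ⟨φ, φ̄⟩; in particular exp(B) φ is also a generalized Calabi–Yau structure on V. -/
set_option synthInstance.maxHeartbeats 1000000
set_option maxHeartbeats 1000000
set_option maxSynthPendingDepth 3

open Module LinearMap TensorProduct

noncomputable section

variable (𝕜 : Type*) [Field 𝕜] (V : Type*) [AddCommGroup V] [Module 𝕜 V]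

variable (W : Type*) [AddCommGroup W] [Module ℝ W]

/-- real truncated exponential in `Λ V*` -/
def gExpR (V : Type*) [AddCommGroup V] [Module ℝ V] (n : ℕ) (B : Sp ℝ V) : Sp ℝ V :=
  ∑ k ∈ Finset.range (n + 1), (k.factorial : ℝ)⁻¹ • B ^ k

theorem exteriorPower_two_induction_s8 {R M : Type*} [CommRing R] [AddCommGroup M] [Module R M]
    {C : ExteriorAlgebra R M → Prop}
    (ι_mul_ι : ∀ a b : M, C (ExteriorAlgebra.ι R a * ExteriorAlgebra.ι R b))
    (add : ∀ x y, C x → C y → C (x + y))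
    {B : ExteriorAlgebra R M} (hB : B ∈ ⋀[R]^2 M) : C B := by
  rw [ExteriorAlgebra.exteriorPower, pow_two] at hB
  refine Submodule.mul_induction_on hB ?_ add
  rintro _ ⟨a, rfl⟩ _ ⟨b, rfl⟩
  exact ι_mul_ι a b

section TwoForm

variable {R M : Type*} [CommRing R] [AddCommGroup M] [Module R M] {B : ExteriorAlgebra R M}

theorem ι_mul_ι_swap_s8 (a b : M) :
    ExteriorAlgebra.ι R a * ExteriorAlgebra.ι R b =
      -(ExteriorAlgebra.ι R b * ExteriorAlgebra.ι R a) :=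
  eq_neg_of_add_eq_zero_left (ExteriorAlgebra.ι_add_mul_swap a b)

theorem commute_of_mem_exteriorPower_two (hB : B ∈ ⋀[R]^2 M) (x : ExteriorAlgebra R M) :
    Commute B x := by
  induction x using ExteriorAlgebra.induction with
  | algebraMap r => exact Algebra.commute_algebraMap_right r B
  | ι v =>
    refine exteriorPower_two_induction_s8 (C := fun B => Commute B (ExteriorAlgebra.ι R v))
      (fun a b => ?_) (fun _ _ => Commute.add_left) hB
    rw [commute_iff_eq, mul_assoc, ι_mul_ι_swap_s8 b v, mul_neg, ← mul_assoc, ι_mul_ι_swap_s8 a v,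
      neg_mul, neg_neg, mul_assoc]
  | mul _ _ hx hy => exact hx.mul_right hy
  | add _ _ hx hy => exact hx.add_right hy

theorem reverse_of_mem_exteriorPower_two (hB : B ∈ ⋀[R]^2 M) :
    CliffordAlgebra.reverse (Q := (0 : QuadraticForm R M)) B = -B := by
  refine exteriorPower_two_induction_s8
    (C := fun B => CliffordAlgebra.reverse (Q := (0 : QuadraticForm R M)) B = -B)
    (fun a b => ?_) (fun x y hx hy => ?_) hB
  · rw [CliffordAlgebra.reverse.map_mul, ExteriorAlgebra.ι, CliffordAlgebra.reverse_ι,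
      CliffordAlgebra.reverse_ι]
    exact ι_mul_ι_swap_s8 b a
  · rw [map_add, hx, hy, neg_add]

theorem contractLeft_mul_of_mem_exteriorPower_two (hB : B ∈ ⋀[R]^2 M) (d : Module.Dual R M)
    (x : ExteriorAlgebra R M) :
    CliffordAlgebra.contractLeft (Q := (0 : QuadraticForm R M)) d (B * x) =
      CliffordAlgebra.contractLeft (Q := (0 : QuadraticForm R M)) d B * x +
        B * CliffordAlgebra.contractLeft (Q := (0 : QuadraticForm R M)) d x := by
  refine exteriorPower_two_induction_s8
    (C := fun B => CliffordAlgebra.contractLeft (Q := (0 : QuadraticForm R M)) d (B * x) =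
      CliffordAlgebra.contractLeft (Q := (0 : QuadraticForm R M)) d B * x +
        B * CliffordAlgebra.contractLeft (Q := (0 : QuadraticForm R M)) d x)
    (fun a b => ?_) (fun y z hy hz => ?_) hB
  · rw [ExteriorAlgebra.ι, mul_assoc]
    simp only [CliffordAlgebra.contractLeft_ι_mul, CliffordAlgebra.contractLeft_ι]
    simp only [mul_sub, sub_mul, mul_smul_comm, smul_mul_assoc, mul_assoc,
      ← Algebra.commutes, ← Algebra.smul_def]
    abel
  · rw [add_mul, map_add, hy, hz, map_add, add_mul, add_mul]
    abel

theorem contractLeft_pow_succ_mul_of_mem_exteriorPower_two (hB : B ∈ ⋀[R]^2 M)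
    (d : Module.Dual R M) (k : ℕ) (x : ExteriorAlgebra R M) :
    CliffordAlgebra.contractLeft (Q := (0 : QuadraticForm R M)) d (B ^ (k + 1) * x) =
      (k + 1 : R) • (B ^ k *
        (CliffordAlgebra.contractLeft (Q := (0 : QuadraticForm R M)) d B * x)) +
        B ^ (k + 1) * CliffordAlgebra.contractLeft (Q := (0 : QuadraticForm R M)) d x := by
  induction k generalizing x with
  | zero => simp [contractLeft_mul_of_mem_exteriorPower_two hB]
  | succ k ih =>
    rw [pow_succ, mul_assoc, ih, contractLeft_mul_of_mem_exteriorPower_two hB, mul_add,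
      ← mul_assoc _ B x, ← (commute_of_mem_exteriorPower_two hB _).eq, mul_assoc B,
      ← mul_assoc _ B, ← pow_succ, Nat.cast_succ, add_smul (k + 1 : R) 1, one_smul,
      ← mul_assoc _ B, ← pow_succ]
    abel

theorem exists_ι_eq_contractLeft_of_mem_exteriorPower_two (hB : B ∈ ⋀[R]^2 M) :
    ∃ c : Module.Dual R M →ₗ[R] M, ∀ d, ExteriorAlgebra.ι R (c d) =
      CliffordAlgebra.contractLeft (Q := (0 : QuadraticForm R M)) d B := by
  refine exteriorPower_two_induction_s8
    (C := fun B => ∃ c : Module.Dual R M →ₗ[R] M, ∀ d, ExteriorAlgebra.ι R (c d) =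
      CliffordAlgebra.contractLeft (Q := (0 : QuadraticForm R M)) d B)
    (fun a b => ?_) ?_ hB
  · refine ⟨(Module.Dual.eval R M a).smulRight b - (Module.Dual.eval R M b).smulRight a,
      fun d => ?_⟩
    simp only [ExteriorAlgebra.ι, CliffordAlgebra.contractLeft_ι_mul,
      CliffordAlgebra.contractLeft_ι, ← Algebra.commutes, ← Algebra.smul_def]
    simp
  · rintro y z ⟨c, hc⟩ ⟨c', hc'⟩
    exact ⟨c + c', fun d => by simp [hc, hc']⟩

end TwoForm

section Exp

variable {W} {B : Sp ℝ W}

theorem pow_eq_zero_of_mem_exteriorPower_two [FiniteDimensional ℝ W]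
    (hB : B ∈ ⋀[ℝ]^2 (Module.Dual ℝ W)) : B ^ (Module.finrank ℝ W + 1) = 0 := by
  have h := Submodule.pow_mem_pow _ hB (Module.finrank ℝ W + 1)
  rw [← pow_mul] at h
  have h0 : Module.finrank ℝ (⋀[ℝ]^(2 * (Module.finrank ℝ W + 1)) (Module.Dual ℝ W)) = 0 := by
    rw [exteriorPower.finrank_eq, Subspace.dual_finrank_eq, Nat.choose_eq_zero_of_lt (by lia)]
  have h' := Submodule.finrank_eq_zero.1 h0
  rw [ExteriorAlgebra.exteriorPower] at h'
  rwa [h', Submodule.mem_bot] at h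

theorem gExpR_mul_gExpR_neg {n : ℕ} (hB : B ^ (n + 1) = 0) :
    gExpR W n (-B) * gExpR W n B = 1 := by
  let _ : Module ℚ (Sp ℝ W) := Module.compHom _ (algebraMap ℚ ℝ)
  have key (A : Sp ℝ W) (hA : A ^ (n + 1) = 0) : gExpR W n A = IsNilpotent.exp A := by
    rw [IsNilpotent.exp_eq_sum hA, gExpR]
    refine Finset.sum_congr rfl fun k _ => ?_
    change _ = algebraMap ℚ ℝ (k.factorial : ℚ)⁻¹ • A ^ k
    simp
  rw [key B hB, key (-B) (by rw [neg_pow, hB, mul_zero])]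
  exact IsNilpotent.exp_neg_mul_exp_self ⟨_, hB⟩

theorem reverse_gExpR (hB : B ∈ ⋀[ℝ]^2 (Module.Dual ℝ W)) (n : ℕ) :
    CliffordAlgebra.reverse (Q := (0 : QuadraticForm ℝ (Module.Dual ℝ W))) (gExpR W n B) =
      gExpR W n (-B) := by
  have hpow (k : ℕ) : CliffordAlgebra.reverse (Q := (0 : QuadraticForm ℝ (Module.Dual ℝ W)))
      (B ^ k) = (-B) ^ k := by
    induction k with
    | zero => simp
    | succ k ih =>
      rw [pow_succ, CliffordAlgebra.reverse.map_mul, ih, reverse_of_mem_exteriorPower_two hB,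
        ← pow_succ']
  simp only [gExpR, map_sum, map_smul, hpow]

theorem commute_gExpR (hB : B ∈ ⋀[ℝ]^2 (Module.Dual ℝ W)) (n : ℕ) (x : Sp ℝ W) :
    Commute (gExpR W n B) x :=
  Commute.sum_left _ _ _ fun k _ =>
    ((commute_of_mem_exteriorPower_two hB x).pow_left k).smul_left _

theorem contractLeft_gExpR_mul (hB : B ∈ ⋀[ℝ]^2 (Module.Dual ℝ W)) {n : ℕ}
    (hn : B ^ (n + 1) = 0) (d : Module.Dual ℝ (Module.Dual ℝ W)) (x : Sp ℝ W) :
    CliffordAlgebra.contractLeft (Q := (0 : QuadraticForm ℝ (Module.Dual ℝ W))) d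
        (gExpR W n B * x) =
      gExpR W n B *
        (CliffordAlgebra.contractLeft (Q := (0 : QuadraticForm ℝ (Module.Dual ℝ W))) d B * x +
          CliffordAlgebra.contractLeft (Q := (0 : QuadraticForm ℝ (Module.Dual ℝ W))) d x) := by
  set D := CliffordAlgebra.contractLeft (Q := (0 : QuadraticForm ℝ (Module.Dual ℝ W))) d with hD
  have top : B ^ n * (D B * x) = 0 := by
    have h := contractLeft_pow_succ_mul_of_mem_exteriorPower_two hB d n x
    rw [hn, zero_mul, zero_mul, map_zero, add_zero] at h
    exact (smul_eq_zero.1 h.symm).resolve_left (by positivity)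
  have hfac (k : ℕ) : ((k + 1).factorial : ℝ)⁻¹ * (k + 1) = (k.factorial : ℝ)⁻¹ := by
    rw [Nat.factorial_succ]
    push_cast
    field_simp
  have hE : gExpR W n B * (D B * x) =
      ∑ k ∈ Finset.range n, (k.factorial : ℝ)⁻¹ • (B ^ k * (D B * x)) := by
    rw [gExpR, Finset.sum_mul, Finset.sum_range_succ, smul_mul_assoc, top, smul_zero, add_zero]
    simp only [smul_mul_assoc]
  rw [mul_add, hE]
  simp only [gExpR, Finset.sum_mul, map_sum, smul_mul_assoc, map_smul]
  rw [Finset.sum_range_succ', Finset.sum_range_succ' _ n, ← add_assoc, ← Finset.sum_add_distrib]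
  simp only [hD, contractLeft_pow_succ_mul_of_mem_exteriorPower_two hB, smul_add, smul_smul, hfac,
    pow_zero, one_mul]

theorem gAct_gExpR_mul (hB : B ∈ ⋀[ℝ]^2 (Module.Dual ℝ W)) {n : ℕ} (hn : B ^ (n + 1) = 0)
    {c : Module.Dual ℝ (Module.Dual ℝ W) →ₗ[ℝ] Module.Dual ℝ W}
    (hc : ∀ d, ExteriorAlgebra.ι ℝ (c d) =
      CliffordAlgebra.contractLeft (Q := (0 : QuadraticForm ℝ (Module.Dual ℝ W))) d B)
    (v : W) (ξ : Module.Dual ℝ W) (x : Sp ℝ W) :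
    gAct ℝ W (v, ξ) (gExpR W n B * x) =
      gExpR W n B * gAct ℝ W (v, ξ + c (Module.Dual.eval ℝ W v)) x := by
  simp only [gAct, LinearMap.add_apply, LinearMap.comp_apply, LinearMap.fst_apply,
    LinearMap.snd_apply, LinearMap.mul_apply', map_add, hc, contractLeft_gExpR_mul hB hn, mul_add]
  rw [← mul_assoc (ExteriorAlgebra.ι ℝ ξ), ← (commute_gExpR hB n _).eq, mul_assoc]
  abel

end Exp

section Complexification

variable {W}

/-- the shear `(v, ξ) ↦ (v, ξ + f v)` of `W ⊕ W*` -/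
def shear (f : W →ₗ[ℝ] Module.Dual ℝ W) :
    (W × Module.Dual ℝ W) ≃ₗ[ℝ] (W × Module.Dual ℝ W) :=
  (LinearEquiv.refl ℝ W).skewProd (LinearEquiv.refl ℝ (Module.Dual ℝ W)) f

theorem revSC_tmul_mul (a : Sp ℝ W) (φ : SpC W) :
    revSC W ((1 ⊗ₜ a) * φ) = revSC W φ * (1 ⊗ₜ CliffordAlgebra.reverse
      (Q := (0 : QuadraticForm ℝ (Module.Dual ℝ W))) a) := by
  induction φ using TensorProduct.induction_on with
  | zero => simp
  | tmul z s =>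
    simp only [revSC, Algebra.TensorProduct.tmul_mul_tmul, LinearMap.baseChange_tmul, one_mul,
      mul_one]
    rw [CliffordAlgebra.reverse.map_mul]
  | add _ _ hx hy => rw [mul_add, map_add, hx, hy, map_add, add_mul]

theorem conjSC_tmul_mul (a : Sp ℝ W) (φ : SpC W) :
    conjSC W ((1 ⊗ₜ a) * φ) = (1 ⊗ₜ a) * conjSC W φ := by
  induction φ using TensorProduct.induction_on with
  | zero => simp
  | tmul z s => simp [conjSC]
  | add _ _ hx hy => rw [mul_add, map_add, hx, hy, map_add, mul_add]

theorem pairSC_conjSC_tmul_mul {a : Sp ℝ W}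
    (ha : CliffordAlgebra.reverse (Q := (0 : QuadraticForm ℝ (Module.Dual ℝ W))) a * a = 1)
    (n : ℕ) (φ : SpC W) :
    pairSC W n ((1 ⊗ₜ a) * φ) (conjSC W ((1 ⊗ₜ a) * φ)) = pairSC W n φ (conjSC W φ) := by
  rw [pairSC, pairSC, revSC_tmul_mul, conjSC_tmul_mul, mul_assoc, ← mul_assoc (1 ⊗ₜ _),
    Algebra.TensorProduct.tmul_mul_tmul, ha, one_mul, ← Algebra.TensorProduct.one_def, one_mul]

theorem actC_tmul_mul {a : Sp ℝ W} {T : (W × Module.Dual ℝ W) ≃ₗ[ℝ] (W × Module.Dual ℝ W)}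
    (hT : ∀ u x, gAct ℝ W u (a * x) = a * gAct ℝ W (T u) x)
    (u : ℂ ⊗[ℝ] (W × Module.Dual ℝ W)) (φ : SpC W) :
    actC W u ((1 ⊗ₜ a) * φ) = (1 ⊗ₜ a) * actC W (T.baseChange ℝ ℂ _ _ u) φ := by
  induction u using TensorProduct.induction_on with
  | zero => simp
  | add _ _ hx hy =>
    simp only [map_add, LinearMap.add_apply, mul_add, hx, hy]
  | tmul z u =>
    induction φ using TensorProduct.induction_on with
    | zero => simp
    | add _ _ hx hy => simp only [map_add, mul_add, hx, hy]
    | tmul w s => simp [actC, hT]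

theorem finrank_annC_tmul_mul {a b : Sp ℝ W} (hab : b * a = 1)
    {T : (W × Module.Dual ℝ W) ≃ₗ[ℝ] (W × Module.Dual ℝ W)}
    (hT : ∀ u x, gAct ℝ W u (a * x) = a * gAct ℝ W (T u) x) (φ : SpC W) :
    Module.finrank ℂ (annC W ((1 ⊗ₜ a) * φ)) = Module.finrank ℂ (annC W φ) := by
  have hinj (y : SpC W) (hy : (1 ⊗ₜ a : SpC W) * y = 0) : y = 0 := by
    have h : (1 ⊗ₜ b : SpC W) * ((1 ⊗ₜ a) * y) = y := by
      rw [← mul_assoc, Algebra.TensorProduct.tmul_mul_tmul, hab, one_mul,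
        ← Algebra.TensorProduct.one_def, one_mul]
    rw [← h, hy, mul_zero]
  have hcomap : annC W ((1 ⊗ₜ a) * φ) =
      (annC W φ).comap (T.baseChange ℝ ℂ _ _).toLinearMap := by
    ext u
    simp only [annC, Submodule.mem_comap, LinearMap.mem_ker, LinearMap.flip_apply,
      LinearEquiv.coe_coe, actC_tmul_mul hT]
    exact ⟨hinj _, fun h => by rw [h, mul_zero]⟩
  rw [hcomap]
  exact ((T.baseChange ℝ ℂ _ _).ofSubmodule' (annC W φ)).finrank_eq

end Complexification

/-- if `φ` is a generalized Calabi–Yau structure on `V` and `B ∈ Λ²V*` is a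
real 2-form, then `⟨exp(B) φ, conj(exp(B) φ)⟩ = ⟨φ, φ̄⟩`; in particular `exp(B) φ` is also a
generalized Calabi–Yau structure on `V`. -/
theorem b_field_transform_of_GCY
    (V : Type*) [AddCommGroup V] [Module ℝ V] [FiniteDimensional ℝ V]
    (φ : SpC V) (hφ : IsGCY V φ)
    (B : Sp ℝ V) (hBdeg : B ∈ ⋀[ℝ]^2 (Module.Dual ℝ V)) :
    pairSC V (Module.finrank ℝ V)
        (((1 : ℂ) ⊗ₜ gExpR V (Module.finrank ℝ V) B) * φ)
        (conjSC V (((1 : ℂ) ⊗ₜ gExpR V (Module.finrank ℝ V) B) * φ)) =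
      pairSC V (Module.finrank ℝ V) φ (conjSC V φ) ∧
    IsGCY V (((1 : ℂ) ⊗ₜ gExpR V (Module.finrank ℝ V) B) * φ) := by
  have hn := pow_eq_zero_of_mem_exteriorPower_two hBdeg
  have hinv := gExpR_mul_gExpR_neg hn
  obtain ⟨c, hc⟩ := exists_ι_eq_contractLeft_of_mem_exteriorPower_two hBdeg
  have hpair := pairSC_conjSC_tmul_mul ((reverse_gExpR hBdeg _).symm ▸ hinv)
    (Module.finrank ℝ V) φ
  refine ⟨hpair, ?_, hpair ▸ hφ.2⟩
  exact (finrank_annC_tmul_mul hinv (T := shear (c ∘ₗ Module.Dual.eval ℝ V))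
    (fun u x => gAct_gExpR_mul hBdeg hn hc u.1 u.2 x) φ).trans hφ.1
end
end

section
/- Let a compact Lie group G act freely on a generalized Calabi–Yau manifold (M, φ) in a Hamiltonian way with generalized moment map μ, let p ∈ μ⁻¹(0), and let π: (TM ⊕ T*M) ⊗ ℂ → TM ⊗ ℂ be the projection. Then dim_ℂ ((T_p μ⁻¹(0) ⊗ ℂ) ∩ π(E_φ)_p) = dim_ℂ π(E_φ)_p − dim G. -/
set_option synthInstance.maxHeartbeats 1000000
set_option maxHeartbeats 1000000
set_option maxSynthPendingDepth 3

open Module LinearMap TensorProduct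

noncomputable section

variable (𝕜 : Type*) [Field 𝕜] (V : Type*) [AddCommGroup V] [Module 𝕜 V]

variable (W : Type*) [AddCommGroup W] [Module ℝ W]

namespace CliffordAlgebra

variable {R M : Type*} [CommRing R] [AddCommGroup M] [Module R M]

theorem contractLeft_mem_exteriorPower (d : Module.Dual R M) {k : ℕ} {x : ExteriorAlgebra R M}
    (hx : x ∈ ⋀[R]^k M) :
    contractLeft (Q := (0 : QuadraticForm R M)) d x ∈ ⋀[R]^(k - 1) M := by
  refine Submodule.pow_induction_on_left' (M := LinearMap.range (ExteriorAlgebra.ι R (M := M)))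
    (C := fun k x _ => contractLeft (Q := (0 : QuadraticForm R M)) d x ∈ ⋀[R]^(k - 1) M)
    ?_ ?_ ?_ hx
  · intro r
    rw [show algebraMap R (ExteriorAlgebra R M) r
      = algebraMap R (CliffordAlgebra (0 : QuadraticForm R M)) r from rfl, contractLeft_algebraMap]
    exact Submodule.zero_mem _
  · intro x y i _ _ hx hy
    rw [map_add]
    exact add_mem hx hy
  · rintro _ ⟨m, rfl⟩ i x hx ih
    have h := contractLeft_ι_mul (Q := (0 : QuadraticForm R M)) d m x
    rw [show ExteriorAlgebra.ι R m * x = ι (0 : QuadraticForm R M) m * x from rfl, h]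
    refine sub_mem (Submodule.smul_mem _ _ hx) ?_
    rcases i with _ | i
    · obtain ⟨r, rfl⟩ := Submodule.mem_one.mp (by simpa using hx)
      rw [show algebraMap R (ExteriorAlgebra R M) r
        = algebraMap R (CliffordAlgebra (0 : QuadraticForm R M)) r from rfl,
        contractLeft_algebraMap, mul_zero]
      exact Submodule.zero_mem _
    · simp only [Nat.succ_eq_add_one, Nat.add_sub_cancel] at ih ⊢
      change _ ∈ LinearMap.range (ExteriorAlgebra.ι R) ^ (i + 1)
      rw [pow_succ']
      exact Submodule.mul_mem_mul ⟨m, rfl⟩ ih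

end CliffordAlgebra

section GradedSpinors

variable {K E : Type*} [Field K] [AddCommGroup E] [Module K E]

theorem gProj_of_mem_ne {m n : ℕ} (hmn : m ≠ n) {x : Sp K E}
    (hx : x ∈ ⋀[K]^m (Module.Dual K E)) : gProj K E n x = 0 :=
  DirectSum.decompose_of_mem_ne (fun i : ℕ => ⋀[K]^i (Module.Dual K E)) hx hmn

theorem gProj_finrank_contractLeft [FiniteDimensional K E] (d : Module.Dual K (Module.Dual K E))
    (x : Sp K E) :
    gProj K E (finrank K E)
      (CliffordAlgebra.contractLeft (Q := (0 : QuadraticForm K (Module.Dual K E))) d x) = 0 := by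
  have hx : x ∈ ⨆ i : ℕ, ⋀[K]^i (Module.Dual K E) := by
    rw [(DirectSum.Decomposition.isInternal
      (fun i : ℕ => ⋀[K]^i (Module.Dual K E))).submodule_iSup_eq_top]
    trivial
  induction hx using Submodule.iSup_induction' with
  | zero => simp
  | add x y _ _ hx hy => rw [map_add, map_add, hx, hy, add_zero]
  | mem i x hi =>
    by_cases hlt : finrank K E < i
    · have h0 : ⋀[K]^i (Module.Dual K E) = ⊥ := by
        rw [← Submodule.finrank_eq_zero, exteriorPower.finrank_eq, Subspace.dual_finrank_eq]
        exact Nat.choose_eq_zero_of_lt hlt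
      rw [h0, Submodule.mem_bot] at hi
      simp [hi]
    by_cases h : i = 0
    · subst h
      obtain ⟨r, rfl⟩ := Submodule.mem_one.mp (by simpa using hi)
      erw [CliffordAlgebra.contractLeft_algebraMap]
      simp
    · exact gProj_of_mem_ne (by omega) (CliffordAlgebra.contractLeft_mem_exteriorPower d hi)

theorem gProj_finrank_contractRight_mul [FiniteDimensional K E]
    (d : Module.Dual K (Module.Dual K E)) (x y : Sp K E) :
    gProj K E (finrank K E)
        (CliffordAlgebra.contractRight (Q := (0 : QuadraticForm K (Module.Dual K E))) x d * y) =
      gProj K E (finrank K E)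
        (x * CliffordAlgebra.contractLeft (Q := (0 : QuadraticForm K (Module.Dual K E))) d y) := by
  induction x using CliffordAlgebra.right_induction generalizing y with
  | algebraMap r =>
    rw [CliffordAlgebra.contractRight_algebraMap, zero_mul, map_zero, ← Algebra.smul_def, map_smul,
      gProj_finrank_contractLeft, smul_zero]
  | add x₁ x₂ h₁ h₂ =>
    simp only [map_add, add_mul, LinearMap.add_apply, h₁, h₂]
  | mul_ι m x ih =>
    have h := ih (CliffordAlgebra.ι _ m * y)
    rw [CliffordAlgebra.contractLeft_ι_mul, mul_sub, map_sub] at h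
    rw [CliffordAlgebra.contractRight_mul_ι, sub_mul, map_sub, mul_assoc, mul_assoc, h]
    simp

theorem gProj_finrank_reverse_gAct_mul [FiniteDimensional K E] (e : E × Module.Dual K E)
    (x y : Sp K E) :
    gProj K E (finrank K E) (CliffordAlgebra.reverse
        (Q := (0 : QuadraticForm K (Module.Dual K E))) (gAct K E e x) * y) =
      gProj K E (finrank K E) (CliffordAlgebra.reverse
        (Q := (0 : QuadraticForm K (Module.Dual K E))) x * gAct K E e y) := by
  have h := gProj_finrank_contractRight_mul (Module.Dual.eval K E e.1)
    (CliffordAlgebra.reverse (Q := (0 : QuadraticForm K (Module.Dual K E))) x) y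
  rw [CliffordAlgebra.contractRight_eq, CliffordAlgebra.reverse_reverse] at h
  have h₂ : CliffordAlgebra.reverse (Q := (0 : QuadraticForm K (Module.Dual K E)))
      (ExteriorAlgebra.ι K e.2 * x) = CliffordAlgebra.reverse
        (Q := (0 : QuadraticForm K (Module.Dual K E))) x * ExteriorAlgebra.ι K e.2 := by
    rw [CliffordAlgebra.reverse.map_mul]
    congr 1
    exact CliffordAlgebra.reverse_ι _
  simp only [gAct, LinearMap.add_apply, LinearMap.comp_apply, LinearMap.fst_apply,
    LinearMap.snd_apply, LinearMap.mul_apply', map_add, add_mul, mul_add, h, h₂, mul_assoc]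

theorem gAct_inr (β : Module.Dual K E) (x : Sp K E) :
    gAct K E (0, β) x = ExteriorAlgebra.ι K β * x := by
  simp [gAct]

theorem gAct_anticomm_inr (e : E × Module.Dual K E) (β : Module.Dual K E) (x : Sp K E) :
    gAct K E e (gAct K E (0, β) x) + gAct K E (0, β) (gAct K E e x) = β e.1 • x := by
  have h := CliffordAlgebra.contractLeft_ι_mul (Q := (0 : QuadraticForm K (Module.Dual K E)))
    (Module.Dual.eval K E e.1) β x
  have h₂ : ExteriorAlgebra.ι K e.2 * (ExteriorAlgebra.ι K β * x) +
      ExteriorAlgebra.ι K β * (ExteriorAlgebra.ι K e.2 * x) = 0 := by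
    rw [← mul_assoc, ← mul_assoc, ← add_mul, ExteriorAlgebra.ι_add_mul_swap, zero_mul]
  rw [gAct_inr, gAct_inr]
  simp only [gAct, LinearMap.add_apply, LinearMap.comp_apply, LinearMap.fst_apply,
    LinearMap.snd_apply, LinearMap.mul_apply', mul_add]
  erw [h]
  rw [Module.Dual.eval_apply]
  refine Eq.trans ?_ (add_zero (β e.1 • x))
  rw [← h₂]
  abel

end GradedSpinors

section ComplexSpinors

variable {U : Type*} [AddCommGroup U] [Module ℝ U]

theorem actC_tmul_tmul (z w : ℂ) (e : U × Module.Dual ℝ U) (x : Sp ℝ U) :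
    actC U (z ⊗ₜ e) (w ⊗ₜ x) = (z * w) ⊗ₜ gAct ℝ U e x := by
  simp [actC, TensorProduct.smul_tmul']

theorem pairSC_actC_real [FiniteDimensional ℝ U] (e : U × Module.Dual ℝ U) (φ ψ : SpC U) :
    pairSC U (finrank ℝ U) (actC U (1 ⊗ₜ e) φ) ψ =
      pairSC U (finrank ℝ U) φ (actC U (1 ⊗ₜ e) ψ) := by
  induction φ using TensorProduct.induction_on with
  | zero => simp [pairSC]
  | add φ₁ φ₂ h₁ h₂ => simp only [pairSC, map_add, add_mul] at h₁ h₂ ⊢; rw [h₁, h₂]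
  | tmul z x =>
    induction ψ using TensorProduct.induction_on with
    | zero => simp [pairSC]
    | add ψ₁ ψ₂ h₁ h₂ => simp only [pairSC, map_add, mul_add] at h₁ h₂ ⊢; rw [h₁, h₂]
    | tmul w y =>
      simp [pairSC, projSC, revSC, actC_tmul_tmul, gProj_finrank_reverse_gAct_mul]

theorem conjSC_actC_real (e : U × Module.Dual ℝ U) (φ : SpC U) :
    conjSC U (actC U (1 ⊗ₜ e) φ) = actC U (1 ⊗ₜ e) (conjSC U φ) := by
  induction φ using TensorProduct.induction_on with
  | zero => simp
  | add φ₁ φ₂ h₁ h₂ => simp only [map_add, h₁, h₂]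
  | tmul z x => simp [conjSC, actC_tmul_tmul]

/-- The evaluation pairing of complexified covectors with complexified vectors. -/
def dualPairC (U : Type*) [AddCommGroup U] [Module ℝ U] :
    (ℂ ⊗[ℝ] Module.Dual ℝ U) →ₗ[ℂ] Module.Dual ℂ (ℂ ⊗[ℝ] U) :=
  LinearMap.liftBaseChange ℂ
    { toFun := fun a => LinearMap.liftBaseChange ℂ (Complex.ofRealAm.toLinearMap.comp a)
      map_add' := fun a b => by ext; simp
      map_smul' := fun r a => by ext; simp }

theorem dualPairC_tmul (z : ℂ) (a : Module.Dual ℝ U) :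
    dualPairC U (z ⊗ₜ a) =
      z • LinearMap.liftBaseChange ℂ (Complex.ofRealAm.toLinearMap.comp a) := by
  simp [dualPairC]

theorem dualPairC_tmul_tmul (z w : ℂ) (a : Module.Dual ℝ U) (v : U) :
    dualPairC U (z ⊗ₜ a) (w ⊗ₜ v) = z * w * a v := by
  simp [dualPairC_tmul, mul_assoc]

theorem dualPairC_surjective : Function.Surjective (dualPairC U) := by
  intro g
  let h : U →ₗ[ℝ] ℂ := (g.restrictScalars ℝ).comp (TensorProduct.mk ℝ ℂ U 1)
  refine ⟨1 ⊗ₜ (Complex.reLm.comp h) + Complex.I ⊗ₜ (Complex.imLm.comp h), ?_⟩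
  ext v
  simp only [AlgebraTensorModule.curry_apply, curry_apply,
    LinearMap.coe_restrictScalars, map_add, LinearMap.add_apply, dualPairC_tmul_tmul]
  simpa [h, mul_comm] using Complex.re_add_im (g (1 ⊗ₜ v))

theorem dualPairC_injective [FiniteDimensional ℝ U] : Function.Injective (dualPairC U) :=
  (LinearMap.injective_iff_surjective_of_finrank_eq_finrank
    (by simp [Subspace.dual_finrank_eq])).mpr dualPairC_surjective

/-- The inclusion of complexified covectors. -/
abbrev covecC (U : Type*) [AddCommGroup U] [Module ℝ U] :
    (ℂ ⊗[ℝ] Module.Dual ℝ U) →ₗ[ℂ] ℂ ⊗[ℝ] (U × Module.Dual ℝ U) :=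
  LinearMap.baseChange ℂ (LinearMap.inr ℝ U (Module.Dual ℝ U))

/-- The projection to complexified vectors. -/
abbrev vecC (U : Type*) [AddCommGroup U] [Module ℝ U] :
    (ℂ ⊗[ℝ] (U × Module.Dual ℝ U)) →ₗ[ℂ] ℂ ⊗[ℝ] U :=
  LinearMap.baseChange ℂ (LinearMap.fst ℝ U (Module.Dual ℝ U))

theorem actC_anticomm_covecC (u : ℂ ⊗[ℝ] (U × Module.Dual ℝ U)) (β : ℂ ⊗[ℝ] Module.Dual ℝ U)
    (φ : SpC U) :
    actC U u (actC U (covecC U β) φ) + actC U (covecC U β) (actC U u φ) =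
      dualPairC U β (vecC U u) • φ := by
  induction u with
  | zero => simp
  | add u₁ u₂ h₁ h₂ =>
    simp only [map_add, LinearMap.add_apply, add_smul, ← h₁, ← h₂]; abel
  | tmul z e =>
    induction β with
    | zero => simp
    | add β₁ β₂ h₁ h₂ =>
      simp only [map_add, LinearMap.add_apply, add_smul, ← h₁, ← h₂]; abel
    | tmul w b =>
      induction φ using TensorProduct.induction_on with
      | zero => simp
      | add φ₁ φ₂ h₁ h₂ => simp only [map_add, smul_add, ← h₁, ← h₂]; abel
      | tmul s x =>
        simp only [LinearMap.baseChange_tmul, actC_tmul_tmul, LinearMap.inr_apply,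
          LinearMap.fst_apply, dualPairC_tmul_tmul]
        rw [show w * (z * s) = z * (w * s) by ring, ← TensorProduct.tmul_add, gAct_anticomm_inr,
          TensorProduct.tmul_smul, TensorProduct.smul_tmul', TensorProduct.smul_tmul']
        congr 1
        simp; ring

theorem mem_annC {φ : SpC U} {u : ℂ ⊗[ℝ] (U × Module.Dual ℝ U)} :
    u ∈ annC U φ ↔ actC U u φ = 0 := Iff.rfl

theorem fst_eq_zero_of_real_mem_annC [FiniteDimensional ℝ U] {φ : SpC U}
    (h : pairSC U (finrank ℝ U) φ (conjSC U φ) ≠ 0) {e : U × Module.Dual ℝ U}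
    (he : (1 : ℂ) ⊗ₜ[ℝ] e ∈ annC U φ) : e.1 = 0 := by
  by_contra hv
  obtain ⟨b, hb⟩ : ∃ b : Module.Dual ℝ U, b e.1 ≠ 0 := by
    by_contra! hb
    exact hv ((Module.forall_dual_apply_eq_zero_iff ℝ _).mp hb)
  have h₁ := actC_anticomm_covecC (1 ⊗ₜ e) (1 ⊗ₜ b) φ
  rw [mem_annC.mp he, map_zero, add_zero] at h₁
  have h₂ := pairSC_actC_real e (actC U (covecC U (1 ⊗ₜ b)) φ) (conjSC U φ)
  rw [h₁, ← conjSC_actC_real, mem_annC.mp he, map_zero] at h₂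
  simp only [LinearMap.baseChange_tmul, dualPairC_tmul_tmul, LinearMap.fst_apply] at h₂
  simp only [pairSC, map_smul, smul_mul_assoc, mul_zero, map_zero] at h₂
  exact (smul_ne_zero (by simpa using hb) h) h₂

theorem dualPairC_eq_zero_of_mem_annC {φ : SpC U} (hφ : φ ≠ 0)
    {u : ℂ ⊗[ℝ] (U × Module.Dual ℝ U)} {β : ℂ ⊗[ℝ] Module.Dual ℝ U}
    (hu : u ∈ annC U φ) (hβ : covecC U β ∈ annC U φ) : dualPairC U β (vecC U u) = 0 := by
  have h := actC_anticomm_covecC u β φ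
  rw [mem_annC.mp hu, mem_annC.mp hβ, map_zero, map_zero, add_zero] at h
  exact (smul_eq_zero.mp h.symm).resolve_right hφ

theorem exact_covecC_vecC : Function.Exact (covecC U) (vecC U) := by
  intro u
  constructor
  · intro hu
    have h : u = LinearMap.baseChange ℂ (LinearMap.inl ℝ U (Module.Dual ℝ U)) (vecC U u) +
        covecC U (LinearMap.baseChange ℂ (LinearMap.snd ℝ U (Module.Dual ℝ U)) u) := by
      clear hu
      induction u with
      | zero => simp
      | add u₁ u₂ h₁ h₂ =>
        simp only [map_add]
        conv_lhs => rw [h₁, h₂]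
        abel
      | tmul z e => simp [← TensorProduct.tmul_add]
    rw [hu, map_zero, zero_add] at h
    exact ⟨_, h.symm⟩
  · rintro ⟨β, rfl⟩
    rw [← LinearMap.comp_apply, ← LinearMap.baseChange_comp, LinearMap.fst_comp_inr]
    simp

theorem covecC_injective : Function.Injective (covecC U) := by
  refine Function.LeftInverse.injective
    (g := LinearMap.baseChange ℂ (LinearMap.snd ℝ U (Module.Dual ℝ U))) fun β => ?_
  rw [← LinearMap.comp_apply, ← LinearMap.baseChange_comp, LinearMap.snd_comp_inr]
  simp

/-- For a maximal isotropic annihilator, every covector that vanishes on its projection to vectors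
lies in it. -/
theorem covecC_mem_annC_of_vanish [FiniteDimensional ℝ U] {φ : SpC U} (hφ : φ ≠ 0)
    (hdim : finrank ℂ (annC U φ) = finrank ℝ U) {β : ℂ ⊗[ℝ] Module.Dual ℝ U}
    (hβ : ∀ v ∈ (annC U φ).map (vecC U), dualPairC U β v = 0) : covecC U β ∈ annC U φ := by
  set N := (annC U φ).comap (covecC U)
  set P := (annC U φ).map (vecC U)
  have hle : N.map (dualPairC U) ≤ P.dualAnnihilator := by
    rintro _ ⟨γ, hγ, rfl⟩
    rw [Submodule.mem_dualAnnihilator]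
    rintro _ ⟨u, hu, rfl⟩
    exact dualPairC_eq_zero_of_mem_annC hφ hu hγ
  have hker : finrank ℂ N = finrank ℂ (LinearMap.ker ((vecC U).domRestrict (annC U φ))) := by
    rw [(Submodule.equivMapOfInjective _ covecC_injective N).finrank_eq,
      (Submodule.equivMapOfInjective _ (annC U φ).subtype_injective _).finrank_eq,
      LinearMap.ker_domRestrict, Submodule.map_comap_subtype, Submodule.map_comap_eq,
      inf_comm, exact_covecC_vecC.linearMap_ker_eq]
  have hrank := ((vecC U).domRestrict (annC U φ)).finrank_range_add_finrank_ker
  rw [LinearMap.range_domRestrict, ← hker, hdim] at hrank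
  change finrank ℂ P + _ = _ at hrank
  have hann := Subspace.finrank_add_finrank_dualAnnihilator_eq P
  rw [Module.finrank_baseChange] at hann
  have heq : N.map (dualPairC U) = P.dualAnnihilator := by
    refine Submodule.eq_of_le_of_finrank_eq hle ?_
    rw [← (Submodule.equivMapOfInjective _ dualPairC_injective N).finrank_eq]
    omega
  have hmem : dualPairC U β ∈ N.map (dualPairC U) := by
    rw [heq, Submodule.mem_dualAnnihilator]
    exact hβ
  obtain ⟨γ, hγ, h⟩ := hmem
  rwa [← dualPairC_injective h]

theorem one_tmul_real_smul {N : Type*} [AddCommGroup N] [Module ℝ N] (r : ℝ) (x : N) :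
    (1 : ℂ) ⊗ₜ[ℝ] (r • x) = (r : ℂ) • ((1 : ℂ) ⊗ₜ[ℝ] x) := by
  rw [TensorProduct.tmul_smul, TensorProduct.smul_tmul', TensorProduct.smul_tmul']
  simp

/-- A complex combination of the moment differentials that vanishes on the projection of the
annihilator has real coefficients. -/
theorem im_eq_zero_of_vanish [FiniteDimensional ℝ U] {φ : SpC U} (hφ : IsGCY U φ)
    {ι : Type*} [Fintype ι] {X : ι → U} (hX : LinearIndependent ℝ X) {a : ι → Module.Dual ℝ U}
    (hm : ∀ i, ((1 : ℂ) ⊗ₜ ((X i, 0) : U × Module.Dual ℝ U)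
        - Complex.I • ((1 : ℂ) ⊗ₜ (((0 : U), a i) : U × Module.Dual ℝ U))) ∈ annC U φ)
    (c : ι → ℂ) (hc : ∀ v ∈ (annC U φ).map (vecC U), ∑ i, c i * dualPairC U (1 ⊗ₜ a i) v = 0)
    (i : ι) : (c i).im = 0 := by
  have hφ0 : φ ≠ 0 := by
    rintro rfl
    exact hφ.2 (by simp [pairSC])
  have hβ : covecC U (∑ i, c i • (1 ⊗ₜ a i)) ∈ annC U φ :=
    covecC_mem_annC_of_vanish hφ0 hφ.1 fun v hv => by simpa using hc v hv
  have h₁ := (annC U φ).sum_mem (t := Finset.univ) fun i _ => (annC U φ).smul_mem (c i) (hm i)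
  have h₂ := (annC U φ).sum_mem (t := Finset.univ)
    fun i _ => (annC U φ).smul_mem ((c i).re : ℂ) (hm i)
  have h₃ := (annC U φ).smul_mem (-Complex.I)
    (sub_mem (add_mem h₁ ((annC U φ).smul_mem Complex.I hβ)) h₂)
  have key : -Complex.I • (∑ i, c i • ((1 : ℂ) ⊗ₜ ((X i, 0) : U × Module.Dual ℝ U)
        - Complex.I • ((1 : ℂ) ⊗ₜ (((0 : U), a i) : U × Module.Dual ℝ U)))
      + Complex.I • covecC U (∑ i, c i • (1 ⊗ₜ a i))
      - ∑ i, ((c i).re : ℂ) • ((1 : ℂ) ⊗ₜ ((X i, 0) : U × Module.Dual ℝ U)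
        - Complex.I • ((1 : ℂ) ⊗ₜ (((0 : U), a i) : U × Module.Dual ℝ U))))
      = (1 : ℂ) ⊗ₜ[ℝ] (∑ i, ((c i).im • ((X i, 0) : U × Module.Dual ℝ U)
          + (c i).re • ((0, a i) : U × Module.Dual ℝ U))) := by
    rw [map_sum, Finset.smul_sum, ← Finset.sum_add_distrib, ← Finset.sum_sub_distrib,
      Finset.smul_sum, TensorProduct.tmul_sum]
    refine Finset.sum_congr rfl fun i _ => ?_
    rw [map_smul, LinearMap.baseChange_tmul, LinearMap.inr_apply, TensorProduct.tmul_add,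
      one_tmul_real_smul, one_tmul_real_smul]
    generalize (1 : ℂ) ⊗ₜ[ℝ] ((X i, 0) : U × Module.Dual ℝ U) = x
    generalize (1 : ℂ) ⊗ₜ[ℝ] (((0 : U), a i) : U × Module.Dual ℝ U) = y
    match_scalars
    · linear_combination Complex.I * Complex.re_add_im (c i) - ((c i).im : ℂ) * Complex.I_sq
    · linear_combination (-((c i).re : ℂ)) * Complex.I_sq
  rw [key] at h₃
  have h₄ := fst_eq_zero_of_real_mem_annC hφ.2 h₃
  exact Fintype.linearIndependent_iff.mp hX (fun i => (c i).im)
    (by simpa [Prod.fst_sum] using h₄) i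

end ComplexSpinors

/-- pointwise formulation, at `p ∈ μ⁻¹(0)`: let a compact Lie group `G` of
dimension `l` act freely on a generalized Calabi–Yau manifold `(M, φ)` in a Hamiltonian way
with generalized moment map `μ`.  At a point `p ∈ μ⁻¹(0)` (tangent space `V`), the
fundamental vectors `X i` of a basis of `𝔤` are linearly independent (the action is free),
`a i = dμ^{ξ_i}` and the generalized moment map condition holds; `T_p μ⁻¹(0) ⊗ ℂ` is the
joint kernel of the complexified `a i`, and `π` is the projection onto `TM ⊗ ℂ`.  Then
`dim_ℂ ((T_p μ⁻¹(0) ⊗ ℂ) ∩ π(E_φ)_p) = dim_ℂ π(E_φ)_p − dim G`. -/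
theorem dim_tangent_level_set_inter_proj_annihilator
    (V : Type*) [AddCommGroup V] [Module ℝ V] [FiniteDimensional ℝ V]
    (φ : SpC V) (hφ : IsGCY V φ)
    (l : ℕ) (X : Fin l → V) (hX : LinearIndependent ℝ X)
    (a : Fin l → Module.Dual ℝ V)
    (hm : ∀ i, ((1 : ℂ) ⊗ₜ ((X i, 0) : V × Module.Dual ℝ V)
        - Complex.I • ((1 : ℂ) ⊗ₜ (((0 : V), a i) : V × Module.Dual ℝ V)))
      ∈ annC V φ) :
    Module.finrank ℂ
        (((⨅ i : Fin l, LinearMap.ker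
              (LinearMap.liftBaseChange ℂ (Complex.ofRealAm.toLinearMap.comp (a i)))) ⊓
            (annC V φ).map
              (LinearMap.baseChange ℂ (LinearMap.fst ℝ V (Module.Dual ℝ V))) :
          Submodule ℂ (ℂ ⊗[ℝ] V))) =
      Module.finrank ℂ
          ((annC V φ).map
            (LinearMap.baseChange ℂ (LinearMap.fst ℝ V (Module.Dual ℝ V)))) - l := by
  set P := (annC V φ).map (vecC V)
  let A : P →ₗ[ℂ] (Fin l → ℂ) :=
    LinearMap.pi fun i => (dualPairC V (1 ⊗ₜ a i)).domRestrict P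
  have hA : LinearMap.range A = ⊤ := by
    by_contra hne
    obtain ⟨f, hf, hle⟩ := Submodule.exists_le_ker_of_lt_top _ (lt_top_iff_ne_top.mpr hne)
    let c : Fin l → ℂ := fun i => f (Pi.single i 1)
    have hfc : ∀ w, f w = ∑ i, c i * w i := fun w => by
      conv_lhs => rw [← Finset.univ_sum_single w, map_sum]
      refine Finset.sum_congr rfl fun i _ => ?_
      rw [show Pi.single i (w i) = w i • (Pi.single i 1 : Fin l → ℂ) by simp [← Pi.single_smul],
        map_smul, smul_eq_mul, mul_comm]
    have hc : ∀ v ∈ P, ∑ i, c i * dualPairC V (1 ⊗ₜ a i) v = 0 := fun v hv =>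
      (hfc _).symm.trans (hle ⟨⟨v, hv⟩, rfl⟩)
    have him := im_eq_zero_of_vanish hφ hX hm c hc
    have hre := im_eq_zero_of_vanish hφ hX hm (fun i => Complex.I * c i) fun v hv => by
      simp_rw [mul_assoc]
      rw [← Finset.mul_sum, hc v hv, mul_zero]
    refine hf (LinearMap.ext fun w => ?_)
    rw [hfc]
    refine Finset.sum_eq_zero fun i _ => ?_
    rw [show c i = 0 from Complex.ext (by simpa using hre i) (him i), zero_mul]
  have hker : (LinearMap.ker A).map P.subtype = (⨅ i : Fin l, LinearMap.ker
      (LinearMap.liftBaseChange ℂ (Complex.ofRealAm.toLinearMap.comp (a i)))) ⊓ P := by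
    rw [inf_comm, ← Submodule.map_comap_subtype]
    congr 1
    ext v
    simp [A, funext_iff, dualPairC_tmul]
  have hrank := A.finrank_range_add_finrank_ker
  rw [hA, finrank_top, Module.finrank_fin_fun] at hrank
  rw [← hker, ← (Submodule.equivMapOfInjective _ P.subtype_injective _).finrank_eq, ← hrank,
    Nat.add_sub_cancel_left]
end
end
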